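/- For every alternating trilinear form T on ℝ^n and all u, v, w ∈ ℝ^n, writing M = ∑_{(l,s,t)} T(e_l,e_s,e_t) c(e_l) ĉ(e_s) ĉ(e_t) (sum over all triples of pairwise distinct indices in {1,…,n}), one has both ∫_{S^{n−1}} Tr( ∑_{i=1}^n ξ_i · c(u) c(v) c(w) c(e_i) M c(ξ) ) dσ(ξ) = 0 and ∫_{S^{n−1}} Tr( ∑_{i=1}^n ξ_i · c(u) c(v) c(w) M c(e_i) c(ξ) ) dσ(ξ) = 0. -/

import Mathlib

open MeasureTheory

noncomputable section

/-- Euclidean space `ℝ^n` with its standard inner product. -/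
abbrev Eucl (n : ℕ) := EuclideanSpace ℝ (Fin n)

/-- The exterior algebra `Λℝ^n`. -/
abbrev ExtAlg (n : ℕ) := ExteriorAlgebra ℝ (Eucl n)

/-- The standard orthonormal basis vector `e_i` of `ℝ^n`. -/
def e (n : ℕ) (i : Fin n) : Eucl n := EuclideanSpace.single i 1

/-- Left exterior multiplication `ε(x)` on `Λℝ^n`. -/
def eps {n : ℕ} (x : Eucl n) : Module.End ℝ (ExtAlg n) :=
  LinearMap.mulLeft ℝ (ExteriorAlgebra.ι ℝ x)

/-- Interior multiplication (contraction) `ι(x)` on `Λℝ^n`, determined by the inner product. -/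
def iot {n : ℕ} (x : Eucl n) : Module.End ℝ (ExtAlg n) :=
  CliffordAlgebra.contractLeft (Q := (0 : QuadraticForm ℝ (Eucl n))) (innerSL ℝ x).toLinearMap

/-- The Clifford action `c(x) = ε(x) − ι(x)`. -/
def c {n : ℕ} (x : Eucl n) : Module.End ℝ (ExtAlg n) := eps x - iot x

/-- The Clifford action `ĉ(x) = ε(x) + ι(x)`. -/
def hc {n : ℕ} (x : Eucl n) : Module.End ℝ (ExtAlg n) := eps x + iot x

/-- The trace of a linear endomorphism of `Λℝ^n`. -/
def Tr {n : ℕ} : Module.End ℝ (ExtAlg n) →ₗ[ℝ] ℝ := LinearMap.trace ℝ (ExtAlg n)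

/-- The surface measure `σ` on the unit sphere `S^{n-1} ⊆ ℝ^n`. -/
def sphMeasure (n : ℕ) : Measure (Metric.sphere (0 : Eucl n) 1) :=
  (volume : Measure (Eucl n)).toSphere

/-- The total surface measure `vol(S^{n-1})` of the unit sphere. -/
def volSph (n : ℕ) : ℝ := (sphMeasure n Set.univ).toReal

lemma End_mul_neg {n : ℕ} (A B : Module.End ℝ (ExtAlg n)) : A * -B = -(A * B) :=
  LinearMap.comp_neg B A

lemma End_neg_mul {n : ℕ} (A B : Module.End ℝ (ExtAlg n)) : -A * B = -(A * B) :=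
  LinearMap.neg_comp B A

lemma eps_mul_eps {n : ℕ} (x y : Eucl n) : eps x * eps y = -(eps y * eps x) := by
  refine LinearMap.ext fun a => ?_
  have h : ExteriorAlgebra.ι ℝ x * ExteriorAlgebra.ι ℝ y =
      -(ExteriorAlgebra.ι ℝ y * ExteriorAlgebra.ι ℝ x) :=
    eq_neg_of_add_eq_zero_left (ExteriorAlgebra.ι_add_mul_swap x y)
  simp only [eps, Module.End.mul_apply, LinearMap.neg_apply, LinearMap.mulLeft_apply]
  rw [← mul_assoc, h, neg_mul, mul_assoc]

lemma iot_mul_iot {n : ℕ} (x y : Eucl n) : iot x * iot y = -(iot y * iot x) := by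
  refine LinearMap.ext fun a => ?_
  exact CliffordAlgebra.contractLeft_comm (Q := (0 : QuadraticForm ℝ (Eucl n))) _ _ a

lemma iot_mul_eps {n : ℕ} (x y : Eucl n) :
    iot x * eps y = (inner ℝ x y : ℝ) • 1 - eps y * iot x := by
  refine LinearMap.ext fun a => ?_
  exact CliffordAlgebra.contractLeft_ι_mul (Q := (0 : QuadraticForm ℝ (Eucl n))) _ _ a

/-- The operators `c(x)` and `ĉ(y)` anticommute. -/
lemma c_mul_hc {n : ℕ} (x y : Eucl n) : c x * hc y = -(hc y * c x) := by
  simp only [c, hc, sub_mul, mul_add, mul_sub, add_mul]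
  rw [eps_mul_eps x y, iot_mul_iot x y, iot_mul_eps x y, iot_mul_eps y x, real_inner_comm]
  abel

/-- The operators `ĉ(x)` and `ĉ(y)` anticommute when `x` and `y` are orthogonal. -/
lemma hc_mul_hc {n : ℕ} {x y : Eucl n} (h : inner ℝ x y = 0) :
    hc x * hc y = -(hc y * hc x) := by
  have h' : inner ℝ y x = 0 := by rw [real_inner_comm, h]
  simp only [hc, mul_add, add_mul]
  rw [eps_mul_eps x y, iot_mul_iot x y, iot_mul_eps x y, iot_mul_eps y x, h, h']
  simp only [zero_smul]
  abel

lemma commute_c_mul_c {n : ℕ} (x y z : Eucl n) : Commute (c x * c y) (hc z) := by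
  rw [Commute, SemiconjBy, mul_assoc, c_mul_hc y z, End_mul_neg, ← mul_assoc, c_mul_hc x z,
    End_neg_mul, neg_neg, mul_assoc]

lemma commute_six_c {n : ℕ} (x₁ x₂ x₃ x₄ x₅ x₆ z : Eucl n) :
    Commute (c x₁ * c x₂ * (c x₃ * c x₄) * (c x₅ * c x₆)) (hc z) :=
  ((commute_c_mul_c x₁ x₂ z).mul_left (commute_c_mul_c x₃ x₄ z)).mul_left
    (commute_c_mul_c x₅ x₆ z)

lemma Tr_mul_comm {n : ℕ} (A B : Module.End ℝ (ExtAlg n)) : Tr (A * B) = Tr (B * A) :=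
  LinearMap.trace_mul_comm ℝ A B

lemma Tr_mul_hc_mul_hc {n : ℕ} {P : Module.End ℝ (ExtAlg n)} {x y : Eucl n}
    (h : inner ℝ x y = 0) (hP : Commute P (hc y)) : Tr (P * (hc x * hc y)) = 0 := by
  have h₁ : Tr (P * (hc x * hc y)) = Tr (P * (hc y * hc x)) := by
    rw [← mul_assoc, Tr_mul_comm, ← mul_assoc, ← hP.eq, mul_assoc]
  have h₂ : Tr (P * (hc x * hc y)) = -Tr (P * (hc y * hc x)) := by
    rw [hc_mul_hc h, End_mul_neg, map_neg]
  linarith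

lemma inner_e_of_ne {n : ℕ} {s t : Fin n} (h : s ≠ t) : inner ℝ (e n s) (e n t) = 0 := by
  rw [e, EuclideanSpace.inner_single_left]
  simp [e, h]

lemma Tr_mul_sum_c_hc_hc_mul {n : ℕ} (f : Fin n → Fin n → Fin n → ℝ)
    {A B : Module.End ℝ (ExtAlg n)}
    (h : ∀ x z : Eucl n, Commute (B * A * c x) (hc z)) :
    Tr (A * (∑ l : Fin n, ∑ s : Fin n, ∑ t : Fin n,
      if l ≠ s ∧ l ≠ t ∧ s ≠ t then
        f l s t • (c (e n l) * hc (e n s) * hc (e n t)) else 0) * B) = 0 := by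
  rw [Tr_mul_comm, ← mul_assoc]
  simp only [Finset.mul_sum, map_sum]
  refine Finset.sum_eq_zero fun l _ => Finset.sum_eq_zero fun s _ => Finset.sum_eq_zero fun t _ => ?_
  split_ifs with hlst
  · rw [mul_smul_comm, map_smul, mul_assoc (c _), ← mul_assoc,
      Tr_mul_hc_mul_hc (inner_e_of_ne hlst.2.2) (h _ _), smul_zero]
  · rw [mul_zero, map_zero]

theorem stmt_6 (n : ℕ) (hn : 0 < n) (T : Eucl n [⋀^Fin 3]→ₗ[ℝ] ℝ) (u v w : Eucl n)
    (M : Module.End ℝ (ExtAlg n))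
    (hM : M = ∑ l : Fin n, ∑ s : Fin n, ∑ t : Fin n,
        if l ≠ s ∧ l ≠ t ∧ s ≠ t then
          T ![e n l, e n s, e n t] • (c (e n l) * hc (e n s) * hc (e n t)) else 0) :
    ((∫ ξ : Metric.sphere (0 : Eucl n) 1,
        Tr (∑ i : Fin n, (ξ : Eucl n) i •
          (c u * c v * c w * c (e n i) * M * ∑ j : Fin n, (ξ : Eucl n) j • c (e n j)))
        ∂sphMeasure n) = 0) ∧
    ((∫ ξ : Metric.sphere (0 : Eucl n) 1,
        Tr (∑ i : Fin n, (ξ : Eucl n) i •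
          (c u * c v * c w * M * c (e n i) * ∑ j : Fin n, (ξ : Eucl n) j • c (e n j)))
        ∂sphMeasure n) = 0) := by
  subst hM
  constructor
  · refine integral_eq_zero_of_ae (Filter.Eventually.of_forall fun ξ => ?_)
    simp only [map_sum, map_smul, Finset.mul_sum (f := fun j => (ξ : Eucl n) j • c (e n j)),
      mul_smul_comm, Pi.zero_apply]
    refine Finset.sum_eq_zero fun i _ => ?_
    rw [Finset.sum_eq_zero, smul_zero]
    intro j _
    rw [Tr_mul_sum_c_hc_hc_mul (fun l s t => T ![e n l, e n s, e n t]), smul_zero]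
    intro x z
    simpa only [mul_assoc] using commute_six_c (e n j) u v w (e n i) x z
  · refine integral_eq_zero_of_ae (Filter.Eventually.of_forall fun ξ => ?_)
    simp only [map_sum, map_smul, Finset.mul_sum (f := fun j => (ξ : Eucl n) j • c (e n j)),
      mul_smul_comm, Pi.zero_apply]
    refine Finset.sum_eq_zero fun i _ => ?_
    rw [Finset.sum_eq_zero, smul_zero]
    intro j _
    rw [mul_assoc (_ * _) (c (e n i)),
      Tr_mul_sum_c_hc_hc_mul (fun l s t => T ![e n l, e n s, e n t]), smul_zero]
    intro x z
    simpa only [mul_assoc] using commute_six_c (e n i) (e n j) u v w x z
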